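/- Let N ≥ 1, let t₁, …, t_N be distinct positive real numbers, let e₁, e₂, e₃ be the standard basis of ℝ³, let S = {±tⱼeᵢ : 1 ≤ j ≤ N, 1 ≤ i ≤ 3} (the 6N vertices of N concentric regular octahedra), and define φ : ℝ³ \ S → ℝ by φ(x) = Σ_{j=1}^{N} Σ_{i=1}^{3} ( 1/(2‖x − tⱼeᵢ‖) + 1/(2‖x + tⱼeᵢ‖) ). Then the derivative of φ at the origin vanishes, the full second derivative (Hessian) of φ at the origin vanishes, and 0 is not a local maximum of φ. -/

import Mathlib

abbrev OctE := EuclideanSpace ℝ (Fin 3)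

/-- The real inner product as a bilinear map. -/
noncomputable def octI : OctE →L[ℝ] OctE →L[ℝ] ℝ := innerSL ℝ

lemma octI_apply (u v : OctE) : octI u v = inner ℝ u v := rfl

/-- Gradient field of the half unit charge at `a`. -/
noncomputable def octG (a x : OctE) : OctE →L[ℝ] ℝ :=
  (-(1/2) * (‖x - a‖ ^ 3)⁻¹) • octI (x - a)

lemma oct_norm (a x : OctE) (h : x ≠ a) :
    HasFDerivAt (fun y => ‖y - a‖) (‖x - a‖⁻¹ • octI (x - a)) x := by
  have hn : ‖x - a‖ ≠ 0 := norm_ne_zero_iff.mpr (sub_ne_zero.mpr h)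
  have h1 : HasFDerivAt (fun y => ‖y - a‖ ^ 2) (2 • (octI (x - a))) x := by
    have := ((hasFDerivAt_id x).sub_const a).norm_sq
    refine this.congr_fderiv ?_
    ext v
    simp [octI_apply]
  have h2 := h1.sqrt (pow_ne_zero 2 hn)
  have e : (fun y => √(‖y - a‖ ^ 2)) = fun y => ‖y - a‖ := by
    funext y; exact Real.sqrt_sq (norm_nonneg _)
  rw [e, Real.sqrt_sq (norm_nonneg _)] at h2
  refine h2.congr_fderiv ?_
  ext v
  simp
  field_simp

lemma oct_first (a x : OctE) (h : x ≠ a) :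
    HasFDerivAt (fun y => 1 / (2 * ‖y - a‖)) (octG a x) x := by
  have hn : ‖x - a‖ ≠ 0 := norm_ne_zero_iff.mpr (sub_ne_zero.mpr h)
  have h2 : HasDerivAt (fun r : ℝ => 1 / (2 * r)) (-(1/2) * (‖x - a‖ ^ 2)⁻¹) ‖x - a‖ := by
    have := (hasDerivAt_inv hn).const_mul (1/2 : ℝ)
    have e : (fun r : ℝ => 1 / (2 * r)) = fun r => 1 / 2 * r⁻¹ := by
      funext r; simp; ring
    rw [e]
    exact this.congr_deriv (by ring)
  have h3 := h2.comp_hasFDerivAt x (oct_norm a x h)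
  refine h3.congr_fderiv ?_
  unfold octG
  rw [smul_smul]
  congr 1
  field_simp

lemma oct_second (a x : OctE) (h : x ≠ a) :
    HasFDerivAt (octG a)
      ((-(1/2) * (‖x - a‖ ^ 3)⁻¹) • octI +
       ((3/2 * (‖x - a‖ ^ 5)⁻¹) • octI (x - a)).smulRight (octI (x - a))) x := by
  have hn : ‖x - a‖ ≠ 0 := norm_ne_zero_iff.mpr (sub_ne_zero.mpr h)
  have h2 : HasDerivAt (fun r : ℝ => -(1/2) * (r ^ 3)⁻¹) (3/2 * (‖x - a‖ ^ 4)⁻¹) ‖x - a‖ := by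
    have := ((hasDerivAt_pow 3 ‖x - a‖).inv (pow_ne_zero 3 hn)).const_mul (-(1/2) : ℝ)
    refine this.congr_deriv ?_
    push_cast
    field_simp
  have h3 := h2.comp_hasFDerivAt x (oct_norm a x h)
  have h4 : HasFDerivAt (fun y : OctE => octI (y - a))
      octI x := by
    have := octI.hasFDerivAt.comp x
      ((hasFDerivAt_id x).sub_const a)
    exact this
  have h5 := h3.smul h4
  refine h5.congr_fderiv ?_
  have e : 3/2 * (‖x - a‖ ^ 4)⁻¹ * ‖x - a‖⁻¹ = 3/2 * (‖x - a‖ ^ 5)⁻¹ := by field_simp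
  rw [smul_smul, e]
  rfl

lemma oct_ne (i : Fin 3) (s : ℝ) (hs : s ≠ 0) : (0 : OctE) ≠ EuclideanSpace.single i s := by
  intro h
  have := congrArg (fun v : OctE => v i) h
  simp at this
  exact hs this.symm

lemma oct_ineq (T s : ℝ) (hs : 0 < s) (hT : s < T) :
    3 / T < T / (T ^ 2 - s ^ 2) + 2 / √(T ^ 2 + s ^ 2) := by
  have hT0 : 0 < T := hs.trans hT
  have hd : 0 < T ^ 2 - s ^ 2 := by nlinarith
  have h1 : √(T ^ 2 + s ^ 2) ≤ T + s ^ 2 / (2 * T) := by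
    apply Real.sqrt_le_iff.mpr
    constructor
    · positivity
    · have : (T + s ^ 2 / (2 * T)) ^ 2 = T ^ 2 + s ^ 2 + (s ^ 2 / (2 * T)) ^ 2 := by
        field_simp; ring
      rw [this]; nlinarith [sq_nonneg (s ^ 2 / (2 * T))]
  have h2 : 2 / (T + s ^ 2 / (2 * T)) ≤ 2 / √(T ^ 2 + s ^ 2) := by
    apply div_le_div_of_nonneg_left (by norm_num) (by positivity) h1
  have h3 : 3 / T < T / (T ^ 2 - s ^ 2) + 2 / (T + s ^ 2 / (2 * T)) := by
    have : T / (T ^ 2 - s ^ 2) + 2 / (T + s ^ 2 / (2 * T)) - 3 / T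
        = 3 * s ^ 4 / (T * (T ^ 2 - s ^ 2) * (2 * T ^ 2 + s ^ 2)) := by
      have := hd.ne'
      have h' : 2 * T ^ 2 + s ^ 2 ≠ 0 := by positivity
      have e : T + s ^ 2 / (2 * T) = (2 * T ^ 2 + s ^ 2) / (2 * T) := by field_simp
      rw [e]
      field_simp
      ring
    have hp : 0 < 3 * s ^ 4 / (T * (T ^ 2 - s ^ 2) * (2 * T ^ 2 + s ^ 2)) := by positivity
    linarith
  linarith

/-- The origin is a strict minimum along the first axis, one octahedron at a time. -/
lemma oct_axis (T s : ℝ) (hs : 0 < s) (hT : s < T) :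
    ∑ i : Fin 3, (1 / (2 * ‖(0 : OctE) - EuclideanSpace.single i T‖) +
       1 / (2 * ‖(0 : OctE) + EuclideanSpace.single i T‖)) <
    ∑ i : Fin 3, (1 / (2 * ‖(EuclideanSpace.single 0 s : OctE) - EuclideanSpace.single i T‖) +
       1 / (2 * ‖(EuclideanSpace.single 0 s : OctE) + EuclideanSpace.single i T‖)) := by
  have hT0 : 0 < T := hs.trans hT
  have key := oct_ineq T s hs hT
  have a1 : ‖(EuclideanSpace.single 0 s : OctE) - EuclideanSpace.single 0 T‖ = T - s := by
    rw [EuclideanSpace.norm_eq, Fin.sum_univ_three]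
    simp [abs_sub_comm s T, abs_of_pos (sub_pos.mpr hT), Real.sqrt_sq (sub_pos.mpr hT).le]
  have a2 : ‖(EuclideanSpace.single 0 s : OctE) + EuclideanSpace.single 0 T‖ = T + s := by
    rw [EuclideanSpace.norm_eq, Fin.sum_univ_three]
    simp [add_comm s T, abs_of_pos (add_pos hT0 hs), Real.sqrt_sq (add_pos hT0 hs).le]
  have a3 : ‖(EuclideanSpace.single 0 s : OctE) - EuclideanSpace.single 1 T‖ = √(T ^ 2 + s ^ 2) := by
    rw [EuclideanSpace.norm_eq, Fin.sum_univ_three]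
    simp [add_comm]
  have a4 : ‖(EuclideanSpace.single 0 s : OctE) + EuclideanSpace.single 1 T‖ = √(T ^ 2 + s ^ 2) := by
    rw [EuclideanSpace.norm_eq, Fin.sum_univ_three]
    simp [add_comm]
  have a5 : ‖(EuclideanSpace.single 0 s : OctE) - EuclideanSpace.single 2 T‖ = √(T ^ 2 + s ^ 2) := by
    rw [EuclideanSpace.norm_eq, Fin.sum_univ_three]
    simp [add_comm]
  have a6 : ‖(EuclideanSpace.single 0 s : OctE) + EuclideanSpace.single 2 T‖ = √(T ^ 2 + s ^ 2) := by
    rw [EuclideanSpace.norm_eq, Fin.sum_univ_three]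
    simp [add_comm]
  rw [Fin.sum_univ_three, Fin.sum_univ_three, a1, a2, a3, a4, a5, a6]
  simp only [zero_sub, zero_add, norm_neg, EuclideanSpace.norm_single, Real.norm_eq_abs,
    abs_of_pos hT0]
  have hq : √(T ^ 2 + s ^ 2) ≠ 0 := by positivity
  have e1 : 1 / (2 * (T - s)) + 1 / (2 * (T + s)) = T / (T ^ 2 - s ^ 2) := by
    have h1 : T - s ≠ 0 := (sub_pos.mpr hT).ne'
    have h2 : T + s ≠ 0 := by positivity
    rw [show T ^ 2 - s ^ 2 = (T - s) * (T + s) by ring]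
    field_simp
    ring
  rw [e1]
  calc _ = 3 / T := by field_simp; ring
    _ < _ := key
    _ = _ := by field_simp; ring

/-- The electrostatic potential of unit charges at the `6N` vertices of `N`
concentric regular octahedra `{±tⱼeᵢ}` has vanishing derivative and vanishing
Hessian at the origin, but the origin is not a local maximum. -/
theorem concentric_octahedra_potential_flat_at_origin
    (N : ℕ) (hN : 1 ≤ N) (t : Fin N → ℝ) (ht : ∀ j, 0 < t j)
    (htinj : Function.Injective t)
    (phi : EuclideanSpace ℝ (Fin 3) → ℝ)
    (hphi : phi = fun x => ∑ j : Fin N, ∑ i : Fin 3,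
      (1 / (2 * ‖x - EuclideanSpace.single i (t j)‖) +
       1 / (2 * ‖x + EuclideanSpace.single i (t j)‖))) :
    fderiv ℝ phi 0 = 0 ∧ iteratedFDeriv ℝ 2 phi 0 = 0 ∧ ¬ IsLocalMax phi 0 := by
  have hF : ∀ x : OctE, (∀ j i, x ≠ EuclideanSpace.single i (t j) ∧
      x ≠ -EuclideanSpace.single i (t j)) → HasFDerivAt phi
      (∑ j : Fin N, ∑ i : Fin 3, (octG (EuclideanSpace.single i (t j)) x +
        octG (-EuclideanSpace.single i (t j)) x)) x := by
    intro x hx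
    rw [hphi]
    refine HasFDerivAt.fun_sum fun j _ => HasFDerivAt.fun_sum fun i _ => ?_
    have h2 := oct_first _ x (hx j i).2
    simp only [sub_neg_eq_add] at h2
    exact (oct_first _ x (hx j i).1).add h2
  have h0 : ∀ j i, (0 : OctE) ≠ EuclideanSpace.single i (t j) ∧
      (0 : OctE) ≠ -EuclideanSpace.single i (t j) := by
    intro j i
    have := oct_ne i (t j) (ht j).ne'
    exact ⟨this, fun h => this (by rw [← neg_eq_zero.mpr h.symm, neg_neg])⟩
  have hev : ∀ᶠ x : OctE in nhds 0, ∀ j i, x ≠ EuclideanSpace.single i (t j) ∧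
      x ≠ -EuclideanSpace.single i (t j) := by
    rw [Filter.eventually_all]; intro j
    rw [Filter.eventually_all]; intro i
    exact (eventually_ne_nhds (h0 j i).1).and (eventually_ne_nhds (h0 j i).2)
  refine ⟨?_, ?_, ?_⟩
  · rw [(hF 0 h0).fderiv]
    refine Finset.sum_eq_zero fun j _ => Finset.sum_eq_zero fun i _ => ?_
    ext v
    simp [octG]
  · have hfd : fderiv ℝ phi =ᶠ[nhds 0] fun x => ∑ j : Fin N, ∑ i : Fin 3,
        (octG (EuclideanSpace.single i (t j)) x + octG (-EuclideanSpace.single i (t j)) x) := by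
      filter_upwards [hev] with x hx
      exact (hF x hx).fderiv
    have h2 := HasFDerivAt.fun_sum (u := (Finset.univ : Finset (Fin N))) fun j _ =>
      HasFDerivAt.fun_sum (u := (Finset.univ : Finset (Fin 3))) fun i _ =>
      (oct_second _ 0 (h0 j i).1).add (oct_second _ 0 (h0 j i).2)
    have h3 := (h2.congr_of_eventuallyEq hfd).fderiv
    ext m
    rw [iteratedFDeriv_two_apply, h3]
    simp only [ContinuousLinearMap.sum_apply]
    refine Finset.sum_eq_zero fun j _ => ?_
    have hj := ht j
    simp [Fin.sum_univ_three, abs_of_pos hj, EuclideanSpace.inner_single_left, octI_apply, PiLp.inner_apply]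
    field_simp
    ring
  · intro hmax
    have hc : Filter.Tendsto (fun s : ℝ => (EuclideanSpace.single 0 s : OctE))
        (nhdsWithin 0 (Set.Ioi 0)) (nhds 0) := by
      have : Filter.Tendsto (fun s : ℝ => s • (EuclideanSpace.single 0 (1:ℝ) : OctE))
        (nhds 0) (nhds ((0:ℝ) • (EuclideanSpace.single 0 (1:ℝ) : OctE))) :=
        (continuous_id.smul continuous_const).tendsto 0
      rw [zero_smul] at this
      refine (this.mono_left nhdsWithin_le_nhds).congr fun s => ?_
      ext k; simp
    have h1 := hc.eventually hmax
    have h2 : ∀ᶠ s : ℝ in nhdsWithin 0 (Set.Ioi 0), ∀ j, s < t j := by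
      rw [Filter.eventually_all]; intro j
      exact (eventually_lt_nhds (ht j)).filter_mono nhdsWithin_le_nhds
    obtain ⟨s, ⟨hs1, hs2⟩, hs3⟩ := ((h1.and h2).and self_mem_nhdsWithin).exists
    refine absurd hs1 (not_le.mpr ?_)
    rw [hphi]
    have : Nonempty (Fin N) := ⟨⟨0, hN⟩⟩
    exact Finset.sum_lt_sum_of_nonempty Finset.univ_nonempty
      fun j _ => oct_axis (t j) s hs3 (hs2 j)
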